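/- Let k ≥ 2 and let p : ℝ → ℝ be a C^k, π-periodic function with p(θ) > 0 and p(θ) + p''(θ) > 0 for all θ. For a positive C² π-periodic function q, define Θ_q(θ) = arctan(q'(θ)/q(θ)) + θ + π/2, G_q(θ) = (q'/q)(Θ_q(θ)) + (q'/q)(θ), and k_q(θ) = ((q'(θ)² + q(θ)²)·(q'(Θ_q(θ))² + q(Θ_q(θ))²)) / ((q + q'')(θ)·(q + q'')(Θ_q(θ))·q(θ)·q(Θ_q(θ))). Then for every ε > 0 there exists a C^∞, π-periodic function p_ε with p_ε > 0 and p_ε + p_ε'' > 0, such that sup_θ |d^j/dθ^j (p − p_ε)(θ)| < ε for all 0 ≤ j ≤ k, the set of zeros of G_{p_ε} in [0, π) is finite, and k_{p_ε}(θ) ≠ 1 at every zero θ of G_{p_ε}. -/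

import Mathlib

/-- The map sending a tangent angle to the next tangent angle of a candidate
4-periodic configuration: `Θ_q(θ) = arctan(q'(θ)/q(θ)) + θ + π/2`. -/
noncomputable def ThetaMap (q : ℝ → ℝ) (θ : ℝ) : ℝ :=
  Real.arctan (deriv q θ / q θ) + θ + Real.pi / 2

/-- The function whose zeros are the tangent angles of 4-periodic orbits:
`G_q(θ) = (q'/q)(Θ_q(θ)) + (q'/q)(θ)`. -/
noncomputable def Gmap (q : ℝ → ℝ) (θ : ℝ) : ℝ :=
  deriv q (ThetaMap q θ) / q (ThetaMap q θ) + deriv q θ / q θ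

/-- The stability quantity `k_{1,2}` of the 4-periodic orbit through angle `θ`. -/
noncomputable def kMap (q : ℝ → ℝ) (θ : ℝ) : ℝ :=
  (deriv q θ ^ 2 + q θ ^ 2) * (deriv q (ThetaMap q θ) ^ 2 + q (ThetaMap q θ) ^ 2)
    / ((q θ + deriv (deriv q) θ) * (q (ThetaMap q θ) + deriv (deriv q) (ThetaMap q θ))
      * q θ * q (ThetaMap q θ))

open Real Set Filter Topology MeasureTheory Function
open scoped ContDiff

/-! ### Periodic functions -/

theorem periodic_deriv {f : ℝ → ℝ} {c : ℝ} (hf : Periodic f c) : Periodic (deriv f) c := by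
  intro x
  rw [← deriv_comp_add_const, show (fun y => f (y + c)) = f from funext hf]

theorem periodic_iteratedDeriv {f : ℝ → ℝ} {c : ℝ} (hf : Periodic f c) (j : ℕ) :
    Periodic (iteratedDeriv j f) c := by
  induction j with
  | zero => simpa using hf
  | succ j ih => rw [iteratedDeriv_succ]; exact periodic_deriv ih

/-- A strict upper bound on a family of `π`-periodic functions persists for nearby parameters. -/
theorem eventually_forall_lt_of_periodic {E : Type*} [TopologicalSpace E] {F : E → ℝ → ℝ}
    (hF : Continuous (uncurry F)) (hper : ∀ t, Periodic (F t) π) {t₀ : E} {c : ℝ}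
    (h : ∀ x, F t₀ x < c) : ∀ᶠ t in 𝓝 t₀, ∀ x, F t x < c := by
  have h' : ∀ᶠ t in 𝓝 t₀, ∀ x ∈ Icc 0 π, F t x < c :=
    isCompact_Icc.eventually_forall_of_forall_eventually fun x _ =>
      hF.continuousAt.eventually_lt continuousAt_const (h x)
  filter_upwards [h'] with t ht x
  obtain ⟨y, hy, hxy⟩ := (hper t).exists_mem_Ico₀ pi_pos x
  exact hxy ▸ ht y (Ico_subset_Icc_self hy)

theorem exists_pos_le_of_periodic {f : ℝ → ℝ} (hf : Continuous f) (hper : Periodic f π)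
    (hpos : ∀ x, 0 < f x) : ∃ c > 0, ∀ x, c ≤ f x := by
  obtain ⟨y, -, hy⟩ := isCompact_Icc.exists_isMinOn (nonempty_Icc.2 pi_pos.le) hf.continuousOn
  refine ⟨f y, hpos y, fun x => ?_⟩
  obtain ⟨z, hz, hxz⟩ := hper.exists_mem_Ico₀ pi_pos x
  exact hxz ▸ hy (Ico_subset_Icc_self hz)

/-! ### Smooth approximation of periodic functions -/

theorem exists_smooth_periodic_approx_zero {p : ℝ → ℝ} (hp : Continuous p) (hper : Periodic p π)
    {ε : ℝ} (hε : 0 < ε) :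
    ∃ q : ℝ → ℝ, ContDiff ℝ ∞ q ∧ Periodic q π ∧ ∀ x, |p x - q x| < ε := by
  have h : ∀ᶠ s in 𝓝 (0 : ℝ), ∀ x, |p (x + s) - p x| < ε / 2 := by
    refine eventually_forall_lt_of_periodic (F := fun s x => |p (x + s) - p x|) ?_ ?_ ?_
    · simp only [uncurry_def]
      fun_prop
    · intro s x
      simp only [add_right_comm x π s, hper _]
    · intro x
      simpa using hε
  obtain ⟨δ, hδ, hs⟩ := Metric.eventually_nhds_iff.1 h
  let φ : ContDiffBump (0 : ℝ) := ⟨δ / 2, δ, by positivity, by linarith⟩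
  refine ⟨convolution (φ.normed volume) p (ContinuousLinearMap.lsmul ℝ ℝ) volume, ?_, ?_, ?_⟩
  · exact φ.hasCompactSupport_normed.contDiff_convolution_left _ φ.contDiff_normed
      hp.locallyIntegrable
  · intro x
    simp only [convolution_def, add_sub_right_comm x π, hper _]
  · intro x
    have := φ.dist_normed_convolution_le (μ := volume) (g := p) (x₀ := x) (ε := ε / 2)
      hp.aestronglyMeasurable fun y hy => by
        have := hs (y := y - x) (by simpa [dist_eq_norm] using hy) x
        rw [add_sub_cancel] at this
        exact this.le
    rw [dist_comm, Real.dist_eq] at this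
    linarith

theorem abs_le_of_abs_deriv_le_of_periodic {f : ℝ → ℝ} (hf : Differentiable ℝ f) (hper : Periodic f π)
    (h0 : f 0 = 0) {C : ℝ} (hC : ∀ x, |deriv f x| ≤ C) (x : ℝ) : |f x| ≤ C * π := by
  obtain ⟨y, hy, hxy⟩ := hper.exists_mem_Ico₀ pi_pos x
  have := Convex.norm_image_sub_le_of_norm_deriv_le (f := f) (s := univ) (x := 0) (y := y)
    (fun x _ => hf x) (fun x _ => hC x) convex_univ trivial trivial
  rw [h0, sub_zero, sub_zero, Real.norm_eq_abs, Real.norm_eq_abs, abs_of_nonneg hy.1] at this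
  rw [hxy]
  exact this.trans (mul_le_mul_of_nonneg_left hy.2.le ((abs_nonneg _).trans (hC 0)))

/-- A smooth periodic function has a periodic primitive after subtracting its mean. -/
theorem exists_periodic_primitive {q : ℝ → ℝ} (hq : ContDiff ℝ ∞ q) (hper : Periodic q π)
    (a : ℝ) : ∃ r : ℝ → ℝ, ContDiff ℝ ∞ r ∧ Periodic r π ∧ r 0 = a ∧
      ∀ x, deriv r x = q x - (∫ y in (0)..π, q y) / π := by
  set m := (∫ y in (0)..π, q y) / π
  have hd : ∀ x, HasDerivAt (fun x => a + ∫ y in (0)..x, (q y - m)) (q x - m) x := fun x =>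
    (intervalIntegral.integral_hasDerivAt_right
      ((hq.continuous.sub continuous_const).intervalIntegrable _ _)
      (hq.continuous.sub continuous_const).stronglyMeasurable.stronglyMeasurableAtFilter
      (hq.continuous.sub continuous_const).continuousAt).const_add a
  have hd' := fun x => (hd x).deriv
  refine ⟨fun x => a + ∫ y in (0)..x, (q y - m), ?_, ?_, by simp, hd'⟩
  · refine contDiff_infty_iff_deriv.2 ⟨fun x => (hd x).differentiableAt, ?_⟩
    rw [funext hd']
    exact hq.sub contDiff_const
  · intro x
    have hi : ∀ a b, IntervalIntegrable (fun y => q y - m) volume a b := fun a b =>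
      (hq.continuous.sub continuous_const).intervalIntegrable a b
    have h1 : Periodic (fun y => q y - m) π := fun y => by simp only [hper y]
    have h2 := h1.intervalIntegral_add_eq x 0
    have h3 : ∫ y in (0)..π, (q y - m) = 0 := by
      rw [intervalIntegral.integral_sub (hq.continuous.intervalIntegrable _ _)
        (by simp)]
      simp only [intervalIntegral.integral_const, smul_eq_mul, sub_zero, m]
      field_simp
      simp
    rw [zero_add, h3] at h2
    simp only
    rw [← intervalIntegral.integral_add_adjacent_intervals (hi 0 x) (hi x (x + π)), h2, add_zero]

theorem exists_smooth_periodic_approx (k : ℕ) : ∀ {p : ℝ → ℝ}, ContDiff ℝ k p → Periodic p π →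
    ∀ {ε : ℝ}, 0 < ε → ∃ q : ℝ → ℝ, ContDiff ℝ ∞ q ∧ Periodic q π ∧
      ∀ j ≤ k, ∀ x, |iteratedDeriv j (fun t => p t - q t) x| < ε := by
  induction k with
  | zero =>
    intro p hp hper ε hε
    obtain ⟨q, hq, hqper, h⟩ := exists_smooth_periodic_approx_zero hp.continuous hper hε
    refine ⟨q, hq, hqper, fun j hj => ?_⟩
    obtain rfl : j = 0 := by lia
    simpa using h
  | succ k ih =>
    intro p hp hper ε hε
    have hp' : ContDiff ℝ (k + 1) p := by exact_mod_cast hp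
    have hpd : Differentiable ℝ p := hp'.differentiable (by simp)
    have hp1 : ContDiff ℝ k (deriv p) := (contDiff_succ_iff_deriv.1 hp').2.2
    have hπ := pi_gt_three
    set η := ε / (2 * π + 1)
    have hη : 0 < η := by positivity
    have hηε : η * (2 * π + 1) = ε := by simp only [η]; field_simp
    obtain ⟨q, hq, hqper, h⟩ := ih hp1 (periodic_deriv hper) hη
    have h0 : ∀ x, |deriv p x - q x| < η := by simpa using h 0 k.zero_le
    obtain ⟨r, hr, hrper, hr0, hrd⟩ := exists_periodic_primitive hq hqper (p 0)
    set m := (∫ y in (0)..π, q y) / π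
    have hrdiff : Differentiable ℝ r := hr.differentiable (by simp)
    have hm : |m| ≤ η := by
      have h1 : ∫ y in (0)..π, q y = ∫ y in (0)..π, (q y - deriv p y) := by
        rw [intervalIntegral.integral_sub (hq.continuous.intervalIntegrable _ _)
          (hp1.continuous.intervalIntegrable _ _),
          intervalIntegral.integral_deriv_eq_sub (fun x _ => hpd x)
          (hp1.continuous.intervalIntegrable _ _)]
        have := hper 0
        rw [zero_add] at this
        rw [this, sub_self, sub_zero]
      have h2 := intervalIntegral.norm_integral_le_of_norm_le_const (a := 0) (b := π)
        (f := fun y => q y - deriv p y) (C := η) fun x _ => by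
          rw [Real.norm_eq_abs, abs_sub_comm]
          exact (h0 x).le
      simp only [m]
      rw [h1, abs_div, abs_of_pos pi_pos, div_le_iff₀ pi_pos]
      simpa [abs_of_pos pi_pos] using h2
    have hd : deriv (fun t => p t - r t) = fun x => (deriv p x - q x) + m := by
      funext x
      rw [deriv_fun_sub (hpd x) (hrdiff x), hrd x]
      ring
    have hd0 : ∀ x, |deriv (fun t => p t - r t) x| ≤ 2 * η := fun x => by
      rw [hd]
      exact (abs_add_le _ _).trans (by linarith [h0 x])
    refine ⟨r, hr, hrper, fun j hj x => ?_⟩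
    rcases j with _ | _ | j
    · have := abs_le_of_abs_deriv_le_of_periodic (hpd.sub hrdiff)
        (fun x => by simp [hper x, hrper x]) (by simp [hr0]) hd0 x
      rw [iteratedDeriv_zero]
      exact this.trans_lt (by nlinarith)
    · rw [zero_add, iteratedDeriv_one]
      exact (hd0 x).trans_lt (by nlinarith)
    · rw [iteratedDeriv_succ', hd, iteratedDeriv_succ']
      simp only [deriv_add_const']
      rw [← iteratedDeriv_succ']
      exact (h (j + 1) (by lia) x).trans (by nlinarith)

/-! ### Derivatives depending on a parameter -/

theorem contDiff_deriv_param {E : Type*} [NormedAddCommGroup E] [NormedSpace ℝ E] {n : ℕ}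
    {Φ : E → ℝ → ℝ} (hΦ : ContDiff ℝ (n + 1 : ℕ) (uncurry Φ)) :
    ContDiff ℝ n (uncurry fun t => deriv (Φ t)) := by
  have h1 : ContDiff ℝ (n + 1 : ℕ) (uncurry fun (z : E × ℝ) => Φ z.1) :=
    hΦ.comp ((contDiff_fst.comp contDiff_fst).prodMk contDiff_snd)
  have h2 := ContDiff.fderiv (n := n) h1 (contDiff_snd (E := E) (F := ℝ)) (by norm_cast)
  exact h2.clm_apply contDiff_const

theorem contDiff_iteratedDeriv_param {E : Type*} [NormedAddCommGroup E] [NormedSpace ℝ E]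
    {n : ℕ} (j : ℕ) {Φ : E → ℝ → ℝ} (hΦ : ContDiff ℝ (n + j : ℕ) (uncurry Φ)) :
    ContDiff ℝ n (uncurry fun t => iteratedDeriv j (Φ t)) := by
  induction j generalizing Φ with
  | zero => simpa using hΦ
  | succ j ih =>
    simp only [iteratedDeriv_succ']
    exact ih (contDiff_deriv_param hΦ)

/-! ### The tangent angle map in terms of the logarithmic derivative -/

/-- The map `ThetaMap q`, in terms of `u = q' / q`. -/
noncomputable def angleMap (u : ℝ → ℝ) (x : ℝ) : ℝ := arctan (u x) + x + π / 2

/-- The map `Gmap q`, in terms of `u = q' / q`. -/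
noncomputable def angleGap (u : ℝ → ℝ) (x : ℝ) : ℝ := u (angleMap u x) + u x

/-- The derivative of `angleGap u`. -/
noncomputable def angleGapDeriv (u : ℝ → ℝ) (x : ℝ) : ℝ :=
  deriv u (angleMap u x) * (deriv u x / (1 + u x ^ 2) + 1) + deriv u x

theorem angleMap_add_pi {u : ℝ → ℝ} (hu : Periodic u π) (x : ℝ) :
    angleMap u (x + π) = angleMap u x + π := by
  simp only [angleMap, hu x]
  ring

theorem angleGap_periodic {u : ℝ → ℝ} (hu : Periodic u π) : Periodic (angleGap u) π := by
  intro x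
  simp only [angleGap, angleMap_add_pi hu, hu _]

theorem angleGapDeriv_periodic {u : ℝ → ℝ} (hu : Periodic u π) :
    Periodic (angleGapDeriv u) π := by
  intro x
  simp only [angleGapDeriv, angleMap_add_pi hu, hu _, periodic_deriv hu _]

theorem hasDerivAt_angleGap {u : ℝ → ℝ} (hu : Differentiable ℝ u) (x : ℝ) :
    HasDerivAt (angleGap u) (angleGapDeriv u x) x := by
  have h1 : HasDerivAt (angleMap u) (1 / (1 + u x ^ 2) * deriv u x + 1) x :=
    ((hu x).hasDerivAt.arctan.add (hasDerivAt_id x)).add_const _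
  have h2 : HasDerivAt (angleGap u) _ x := ((hu _).hasDerivAt.comp x h1).add (hu x).hasDerivAt
  refine h2.congr_deriv ?_
  simp only [angleGapDeriv]
  ring

section Param

variable {E : Type*} [TopologicalSpace E] {U : E → ℝ → ℝ}

theorem continuous_angleMap_param (hU : Continuous (uncurry U)) :
    Continuous (uncurry fun t => angleMap (U t)) :=
  ((continuous_arctan.comp hU).add continuous_snd).add continuous_const

theorem continuous_angleGap_param (hU : Continuous (uncurry U)) :
    Continuous (uncurry fun t => angleGap (U t)) :=
  (hU.comp (continuous_fst.prodMk (continuous_angleMap_param hU))).add hU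

theorem continuous_angleGapDeriv_param (hU : Continuous (uncurry U))
    (hU' : Continuous (uncurry fun t => deriv (U t))) :
    Continuous (uncurry fun t => angleGapDeriv (U t)) := by
  refine ((hU'.comp (continuous_fst.prodMk (continuous_angleMap_param hU))).mul
    ((hU'.div ((hU.pow 2).const_add 1) fun z => ?_).add continuous_const)).add hU'
  exact (add_pos_of_pos_of_nonneg one_pos (sq_nonneg (uncurry U z))).ne'

end Param

/-- The critical zeros of `angleGap u`. -/
def IsDegenerateAt (u : ℝ → ℝ) (x : ℝ) : Prop := angleGap u x = 0 ∧ angleGapDeriv u x = 0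

theorem isOpen_forall_not_isDegenerateAt {E : Type*} [TopologicalSpace E] {U : E → ℝ → ℝ}
    (hU : Continuous (uncurry U)) (hU' : Continuous (uncurry fun t => deriv (U t))) {K : Set ℝ}
    (hK : IsCompact K) : IsOpen {t | ∀ x ∈ K, ¬ IsDegenerateAt (U t) x} := by
  refine isOpen_iff_mem_nhds.2 fun t ht =>
    hK.eventually_forall_of_forall_eventually fun x hx => ?_
  have : IsClosed {z : E × ℝ | IsDegenerateAt (U z.1) z.2} :=
    (isClosed_eq (continuous_angleGap_param hU) continuous_const).inter
      (isClosed_eq (continuous_angleGapDeriv_param hU hU') continuous_const)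
  exact this.isOpen_compl.mem_nhds (ht x hx)

theorem finite_zeros_angleGap {u : ℝ → ℝ} (hu : Differentiable ℝ u)
    (h : ∀ x, ¬ IsDegenerateAt u x) : {x ∈ Ico 0 π | angleGap u x = 0}.Finite := by
  by_contra hinf
  obtain ⟨z, -, hz⟩ := Set.Infinite.exists_accPt_of_subset_isCompact hinf
    (isCompact_Icc (a := 0) (b := π)) fun x hx => Ico_subset_Icc_self hx.1
  have hd := hasDerivAt_angleGap hu z
  rw [accPt_iff_frequently_nhdsNE] at hz
  have h0 : angleGap u z = 0 := by
    by_contra h0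
    exact hz ((hd.continuousAt.eventually_ne h0).filter_mono nhdsWithin_le_nhds |>.mono
      fun y hy hy' => hy hy'.2)
  exact hz ((hd.eventually_ne (c := 0) fun h1 => h z ⟨h0, h1⟩).mono fun y hy hy' => hy hy'.2)

/-- The one-dimensional Sard lemma. -/
theorem ae_regular_value {f f' : ℝ → ℝ} (hf : ∀ x, HasDerivAt f (f' x) x) :
    ∀ᵐ c : ℝ, ∀ x, f x = c → f' x ≠ 0 := by
  have h := addHaar_image_eq_zero_of_det_fderivWithin_eq_zero volume (s := {x | f' x = 0}) (f := f)
    (fun x _ => (hf x).hasFDerivAt.hasFDerivWithinAt) (fun x hx => by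
      rw [ContinuousLinearMap.det_toSpanSingleton]
      exact hx)
  filter_upwards [measure_eq_zero_iff_ae_notMem.1 h] with c hc x hx hx'
  exact hc ⟨x, hx', hx⟩

/-! ### Transversality -/

section Family

variable {ι : Type*} [Fintype ι] (u₀ : ℝ → ℝ) (h : ι → ℝ → ℝ)

/-- The affine family of functions `u₀ + ∑ i, t i * h i`. -/
def affineFamily (t : ι → ℝ) (x : ℝ) : ℝ := u₀ x + ∑ i, t i * h i x

variable {u₀ h}

theorem hasDerivAt_affineFamily (hu : Differentiable ℝ u₀) (hh : ∀ i, Differentiable ℝ (h i))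
    (t : ι → ℝ) (x : ℝ) : HasDerivAt (affineFamily u₀ h t)
      (affineFamily (deriv u₀) (fun i => deriv (h i)) t x) x :=
  (hu x).hasDerivAt.add <| HasDerivAt.fun_sum fun i _ => ((hh i x).hasDerivAt.const_mul (t i))

theorem deriv_affineFamily (hu : Differentiable ℝ u₀) (hh : ∀ i, Differentiable ℝ (h i))
    (t : ι → ℝ) : deriv (affineFamily u₀ h t) =
      affineFamily (deriv u₀) (fun i => deriv (h i)) t :=
  funext fun x => (hasDerivAt_affineFamily hu hh t x).deriv

theorem contDiff_affineFamily {n : WithTop ℕ∞} (hu : ContDiff ℝ n u₀)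
    (hh : ∀ i, ContDiff ℝ n (h i)) : ContDiff ℝ n (uncurry (affineFamily u₀ h)) := by
  simp only [uncurry_def, affineFamily]
  exact (hu.comp contDiff_snd).add <| ContDiff.sum fun i _ =>
    (((contDiff_apply ℝ ℝ i).comp contDiff_fst).mul ((hh i).comp contDiff_snd))

theorem continuous_affineFamily (hu : Continuous u₀) (hh : ∀ i, Continuous (h i)) :
    Continuous (uncurry (affineFamily u₀ h)) :=
  (contDiff_affineFamily (n := 0) (contDiff_zero.2 hu) fun i => contDiff_zero.2 (hh i)).continuous

theorem affineFamily_zero : affineFamily u₀ h 0 = u₀ := by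
  ext x
  simp [affineFamily]

theorem affineFamily_periodic {c : ℝ} (hu : Periodic u₀ c) (hh : ∀ i, Periodic (h i) c)
    (t : ι → ℝ) : Periodic (affineFamily u₀ h t) c := by
  intro x
  simp only [affineFamily, hu x, hh _ x]

theorem affineFamily_add_single [DecidableEq ι] (t : ι → ℝ) (i : ι) (r x : ℝ) :
    affineFamily u₀ h (t + Pi.single i r) x = affineFamily u₀ h t x + r * h i x := by
  simp only [affineFamily, Pi.add_apply, add_mul, Finset.sum_add_distrib, add_assoc,
    Pi.single_apply, ite_mul, zero_mul, Finset.sum_ite_eq', Finset.mem_univ,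
    if_true]

/-- If varying the `i`-th parameter translates `angleGap` over `K i`, then arbitrarily small
parameters remove all the critical zeros from the sets `K i`. -/
theorem exists_mem_forall_not_isDegenerateAt (hu : ContDiff ℝ 1 u₀) (hh : ∀ i, ContDiff ℝ 1 (h i))
    {K : ι → Set ℝ} (hK : ∀ i, IsCompact (K i)) {V : Set (ι → ℝ)} (hV : IsOpen V)
    (hVne : V.Nonempty)
    (hKh : ∀ i, ∀ x ∈ K i, h i x = 0 ∧ deriv (h i) x = 0)
    (hVh : ∀ t ∈ V, ∀ i, ∀ x ∈ K i, h i (angleMap (affineFamily u₀ h t) x) = 1 ∧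
      deriv (h i) (angleMap (affineFamily u₀ h t) x) = 0) :
    ∃ t ∈ V, ∀ i, ∀ x ∈ K i, ¬ IsDegenerateAt (affineFamily u₀ h t) x := by
  classical
  have hud := hu.differentiable one_ne_zero
  have hhd := fun i => (hh i).differentiable one_ne_zero
  have hder := deriv_affineFamily hud hhd
  have hcont := continuous_affineFamily hu.continuous fun i => (hh i).continuous
  have hcont' : Continuous (uncurry fun t => deriv (affineFamily u₀ h t)) := by
    rw [funext hder]
    exact continuous_affineFamily (hu.continuous_deriv le_rfl)
      fun i => (hh i).continuous_deriv le_rfl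
  set O : ι → Set (ι → ℝ) := fun i => {t | ∀ x ∈ K i, ¬ IsDegenerateAt (affineFamily u₀ h t) x}
  have hO : ∀ i, IsOpen (O i) := fun i => isOpen_forall_not_isDegenerateAt hcont hcont' (hK i)
  have hdense : ∀ i, V ⊆ closure (O i) := by
    intro i t ht
    have hreg : Dense {r : ℝ | ∀ x, angleGap (affineFamily u₀ h t) x = -r →
        angleGapDeriv (affineFamily u₀ h t) x ≠ 0} := by
      have hdiff : Differentiable ℝ (affineFamily u₀ h t) := fun x =>
        (hasDerivAt_affineFamily hud hhd t x).differentiableAt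
      have := Measure.dense_of_ae (ae_regular_value (hasDerivAt_angleGap hdiff))
      exact this.preimage (Homeomorph.neg ℝ).isOpenMap
    have hline : Continuous fun r : ℝ => t + Pi.single i r :=
      continuous_const.add (continuous_single (A := fun _ => ℝ) i)
    have hmem : ∀ r : ℝ, (∀ x, angleGap (affineFamily u₀ h t) x = -r →
        angleGapDeriv (affineFamily u₀ h t) x ≠ 0) → t + Pi.single i r ∈ O i := by
      intro r hr x hx hdeg
      have e1 : affineFamily u₀ h (t + Pi.single i r) x = affineFamily u₀ h t x := by
        rw [affineFamily_add_single, (hKh i x hx).1, mul_zero, add_zero]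
      have e2 : angleMap (affineFamily u₀ h (t + Pi.single i r)) x =
          angleMap (affineFamily u₀ h t) x := by
        simp only [angleMap, e1]
      have e3 : deriv (affineFamily u₀ h (t + Pi.single i r)) x =
          deriv (affineFamily u₀ h t) x := by
        rw [hder, hder, affineFamily_add_single, (hKh i x hx).2, mul_zero, add_zero]
      obtain ⟨h1, h2⟩ := hdeg
      rw [angleGap, e1, e2, affineFamily_add_single, (hVh t ht i x hx).1] at h1
      rw [angleGapDeriv, e1, e2, e3, hder, affineFamily_add_single, (hVh t ht i x hx).2,
        mul_zero, add_zero, ← hder] at h2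
      exact hr x (by rw [angleGap]; linarith) h2
    have h0 : (0 : ℝ) ∈ closure {r : ℝ | ∀ x, angleGap (affineFamily u₀ h t) x = -r →
        angleGapDeriv (affineFamily u₀ h t) x ≠ 0} := hreg 0
    have := map_mem_closure hline h0 hmem
    simpa using this
  have hd : Dense (⋂ i, O i ∪ (closure V)ᶜ) :=
    dense_iInter_of_isOpen (fun i => (hO i).union isClosed_closure.isOpen_compl) fun i t => by
      by_cases htV : t ∈ closure V
      · exact closure_mono subset_union_left (closure_minimal (hdense i) isClosed_closure htV)
      · exact subset_closure (Or.inr htV)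
  obtain ⟨t, htV, ht⟩ := hd.inter_open_nonempty V hV hVne
  refine ⟨t, htV, fun i => ?_⟩
  exact (mem_iInter.1 ht i).resolve_right fun hn => hn (subset_closure htV)

end Family

/-! ### Localized periodic perturbations -/

/-- A smooth `π`-periodic function vanishing near `x₀` and equal to `y - y₀` near `y₀`. It is a
cutoff of `arctan (tan (y - y₀))`. -/
theorem exists_periodic_cutoff {x₀ y₀ : ℝ} (h₁ : x₀ < y₀) (h₂ : y₀ < x₀ + π) :
    ∃ g : ℝ → ℝ, ContDiff ℝ ∞ g ∧ Periodic g π ∧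
      g =ᶠ[𝓝 x₀] (fun _ => 0) ∧ g =ᶠ[𝓝 y₀] (fun y => y - y₀) := by
  obtain ⟨b, hb, hbx⟩ : ∃ b > 0, cos (x₀ - y₀) ≠ 0 → b < |tan (x₀ - y₀)| := by
    by_cases hc : cos (x₀ - y₀) = 0
    · exact ⟨1, one_pos, fun h => absurd hc h⟩
    · have hs : sin (x₀ - y₀) ≠ 0 :=
        (sin_neg_of_neg_of_neg_pi_lt (by linarith) (by linarith)).ne
      have ht : 0 < |tan (x₀ - y₀)| := by
        rw [tan_eq_sin_div_cos]
        positivity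
      exact ⟨_, half_pos ht, fun _ => half_lt_self ht⟩
  let β : ContDiffBump (0 : ℝ) := ⟨b / 2, b, by positivity, by linarith⟩
  have hβ0 : ∀ s : ℝ, b ≤ |s| → β s = 0 := fun s hs =>
    β.zero_of_le_dist (by simpa [Real.dist_eq] using hs)
  have hβ1 : ∀ s : ℝ, |s| ≤ b / 2 → β s = 1 := fun s hs =>
    β.one_of_mem_closedBall (by simpa using hs)
  set g : ℝ → ℝ := fun y => arctan (tan (y - y₀)) * β (tan (y - y₀))
  have hpole : ∀ y, cos (y - y₀) = 0 → g =ᶠ[𝓝 y] fun _ => 0 := by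
    intro y hy
    have hlim : Tendsto (fun z => |tan (z - y₀)|) (𝓝[≠] y) atTop := by
      refine (tendsto_abs_tan_of_cos_eq_zero hy).comp ?_
      refine tendsto_nhdsWithin_iff.2 ⟨?_, ?_⟩
      · exact (Continuous.tendsto (by fun_prop) y).mono_left nhdsWithin_le_nhds
      · exact eventually_mem_nhdsWithin.mono fun z hz h => hz (by simpa using h)
    have := (hlim.eventually_ge_atTop b).mono fun z hz =>
      show g z = 0 by simp only [g, hβ0 _ hz, mul_zero]
    rw [EventuallyEq, ← nhdsNE_sup_pure, eventually_sup, eventually_pure]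
    exact ⟨this, by simp [g, tan_eq_sin_div_cos, hy]⟩
  have htan : ∀ y, cos (y - y₀) ≠ 0 → ContDiffAt ℝ ∞ (fun z => tan (z - y₀)) y := fun y hy =>
    ContDiffAt.comp (g := tan) y (contDiffAt_tan.2 hy) (by fun_prop)
  refine ⟨g, ?_, ?_, ?_, ?_⟩
  · refine contDiff_iff_contDiffAt.2 fun y => ?_
    by_cases hy : cos (y - y₀) = 0
    · exact contDiffAt_const.congr_of_eventuallyEq (hpole y hy)
    · exact (htan y hy).arctan.mul (β.contDiff.contDiffAt.comp y (htan y hy))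
  · intro y
    simp only [g, add_sub_right_comm y π, tan_add_pi]
  · by_cases hy : cos (x₀ - y₀) = 0
    · exact hpole _ hy
    · filter_upwards [(htan x₀ hy).continuousAt.abs.eventually_const_lt (hbx hy)] with z hz
      simp only [g, hβ0 _ hz.le, mul_zero]
  · have h0 : cos (y₀ - y₀) ≠ 0 := by simp
    have hlt : |tan (y₀ - y₀)| < b / 2 := by simpa using hb
    filter_upwards [(htan y₀ h0).continuousAt.abs.eventually_lt_const hlt,
      Ioo_mem_nhds (show y₀ - π / 2 < y₀ by linarith [pi_pos])
        (show y₀ < y₀ + π / 2 by linarith [pi_pos])] with z hz hz'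
    simp only [g, hβ1 _ hz.le, mul_one]
    exact arctan_tan (by linarith [hz'.1]) (by linarith [hz'.2])

/-- For a suitable finite-dimensional family of perturbations of `f₀`, arbitrarily small parameters
yield a function without degenerate zeros of `angleGap`. -/
theorem exists_family_frequently_nondegenerate {f₀ : ℝ → ℝ} (hf : ContDiff ℝ ∞ f₀)
    (hper : Periodic f₀ π) : ∃ (s : Finset ℝ) (g : s → ℝ → ℝ), (∀ i, ContDiff ℝ ∞ (g i)) ∧
      (∀ i, Periodic (g i) π) ∧ ∃ᶠ t in 𝓝 (0 : s → ℝ), ∀ x,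
        ¬ IsDegenerateAt (affineFamily (deriv f₀) (fun i => deriv (g i)) t) x := by
  have hu : ContDiff ℝ ∞ (deriv f₀) := (contDiff_infty_iff_deriv.1 hf).2
  have hangle : Continuous (angleMap (deriv f₀)) :=
    ((continuous_arctan.comp hu.continuous).add continuous_id).add continuous_const
  have hloc : ∀ x, ∃ (g : ℝ → ℝ) (K W : Set ℝ), ContDiff ℝ ∞ g ∧ Periodic g π ∧ IsCompact K ∧
      K ∈ 𝓝 x ∧ IsOpen W ∧ (∀ y ∈ K, deriv g y = 0 ∧ deriv (deriv g) y = 0) ∧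
      (∀ y ∈ K, angleMap (deriv f₀) y ∈ W) ∧
      ∀ y ∈ W, deriv g y = 1 ∧ deriv (deriv g) y = 0 := by
    intro x
    have h1 := neg_pi_div_two_lt_arctan (deriv f₀ x)
    have h2 := arctan_lt_pi_div_two (deriv f₀ x)
    obtain ⟨g, hg, hgper, hgx, hgy⟩ := exists_periodic_cutoff (x₀ := x)
      (y₀ := angleMap (deriv f₀) x) (by rw [angleMap]; linarith) (by rw [angleMap]; linarith)
    have e1 : ∀ᶠ y in 𝓝 (angleMap (deriv f₀) x), deriv g y = 1 ∧ deriv (deriv g) y = 0 := by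
      have h3 : deriv g =ᶠ[𝓝 (angleMap (deriv f₀) x)] fun _ => 1 := by
        simpa using hgy.deriv
      have h4 := h3.deriv
      simp only [deriv_const'] at h4
      exact h3.and h4
    have e2 : ∀ᶠ y in 𝓝 x, deriv g y = 0 ∧ deriv (deriv g) y = 0 := by
      have h3 := hgx.deriv
      have h4 := h3.deriv
      simp only [deriv_const'] at h3 h4
      exact h3.and h4
    obtain ⟨W, hW1, hW, hxW⟩ := eventually_nhds_iff.1 e1
    obtain ⟨K, hKx, hK1, hK⟩ := local_compact_nhds
      (e2.and (hangle.continuousAt.eventually (hW.mem_nhds hxW)))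
    exact ⟨g, K, W, hg, hgper, hK, hKx, hW, fun y hy => (hK1 hy).1, fun y hy => (hK1 hy).2, hW1⟩
  choose g K W hg hgper hK hKx hW hgK hKW hgW using hloc
  obtain ⟨s, -, hs⟩ := (isCompact_Icc (a := 0) (b := π)).elim_nhds_subcover K fun x _ => hKx x
  have hh : ∀ i : s, ContDiff ℝ ∞ (deriv (g i)) := fun i => (contDiff_infty_iff_deriv.1 (hg i)).2
  refine ⟨s, fun i => g i, fun i => hg i, fun i => hgper i, frequently_iff.2 fun {U} hU => ?_⟩
  set F : (s → ℝ) → ℝ → ℝ := affineFamily (deriv f₀) fun i => deriv (g i)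
  have hF : Continuous (uncurry F) :=
    continuous_affineFamily hu.continuous fun i => (hh i).continuous
  have hev : ∀ᶠ t in 𝓝 (0 : s → ℝ), ∀ i : s, ∀ y ∈ K i, angleMap (F t) y ∈ W i := by
    refine eventually_all.2 fun i => (hK i).eventually_forall_of_forall_eventually fun y hy => ?_
    refine (continuous_angleMap_param hF).continuousAt.eventually ((hW i).mem_nhds ?_)
    simp only [uncurry_apply_pair, F, affineFamily_zero]
    exact hKW i y hy
  obtain ⟨V, hVsub, hV, hV0⟩ := mem_nhds_iff.1 (inter_mem hU hev)
  obtain ⟨t, htV, ht⟩ := exists_mem_forall_not_isDegenerateAt (hu.of_le (by simp))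
    (fun i => (hh i).of_le (by simp)) (fun i : s => hK i) hV ⟨0, hV0⟩ (fun i => hgK i)
    fun t ht i x hx => hgW i _ ((hVsub ht).2 i x hx)
  refine ⟨t, (hVsub htV).1, fun x hx => ?_⟩
  have hFper : Periodic (F t) π :=
    affineFamily_periodic (periodic_deriv hper) (fun i : s => periodic_deriv (hgper i)) t
  have hdper : Periodic (IsDegenerateAt (F t)) π := fun y => by
    simp only [IsDegenerateAt, angleGap_periodic hFper y, angleGapDeriv_periodic hFper y]
  obtain ⟨y, hy, hxy⟩ := hdper.exists_mem_Ico₀ pi_pos x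
  obtain ⟨i, hi, hyi⟩ := mem_iUnion₂.1 (hs (Ico_subset_Icc_self hy))
  exact ht ⟨i, hi⟩ y hyi (hxy ▸ hx)

/-! ### Support functions of the form `exp ∘ f` -/

section Exp

variable {f : ℝ → ℝ}

theorem deriv_exp_comp (hf : Differentiable ℝ f) :
    deriv (fun x => exp (f x)) = fun x => exp (f x) * deriv f x :=
  funext fun x => (hf x).hasDerivAt.exp.deriv

theorem deriv_deriv_exp_comp (hf : Differentiable ℝ f) (hf' : Differentiable ℝ (deriv f)) (x : ℝ) :
    deriv (deriv (fun x => exp (f x))) x = exp (f x) * (deriv f x ^ 2 + deriv (deriv f) x) := by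
  rw [deriv_exp_comp hf, ((hf x).hasDerivAt.exp.fun_mul (hf' x).hasDerivAt).deriv]
  ring

theorem thetaMap_exp_comp (hf : Differentiable ℝ f) (x : ℝ) :
    ThetaMap (fun x => exp (f x)) x = angleMap (deriv f) x := by
  simp only [ThetaMap, angleMap, deriv_exp_comp hf]
  rw [mul_div_cancel_left₀ _ (exp_ne_zero _)]

theorem gmap_exp_comp (hf : Differentiable ℝ f) (x : ℝ) :
    Gmap (fun x => exp (f x)) x = angleGap (deriv f) x := by
  simp only [Gmap, angleGap, thetaMap_exp_comp hf, deriv_exp_comp hf]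
  rw [mul_div_cancel_left₀ _ (exp_ne_zero _), mul_div_cancel_left₀ _ (exp_ne_zero _)]

theorem isDegenerateAt_of_kMap_eq_one (hf : Differentiable ℝ f) (hf' : Differentiable ℝ (deriv f))
    {x : ℝ} (hG : Gmap (fun x => exp (f x)) x = 0) (hk : kMap (fun x => exp (f x)) x = 1) :
    IsDegenerateAt (deriv f) x := by
  rw [gmap_exp_comp hf] at hG
  refine ⟨hG, ?_⟩
  rw [kMap, thetaMap_exp_comp hf, deriv_deriv_exp_comp hf hf', deriv_deriv_exp_comp hf hf',
    deriv_exp_comp hf] at hk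
  have hne := (div_ne_zero_iff.1 (hk ▸ one_ne_zero)).2
  rw [div_eq_one_iff_eq hne] at hk
  rw [angleGap] at hG
  rw [angleGapDeriv]
  have ha := exp_pos (f x)
  have hb := exp_pos (f (angleMap (deriv f) x))
  have hv : deriv f (angleMap (deriv f) x) = -deriv f x := by linarith
  simp only [hv] at hk
  generalize exp (f x) = a at *
  generalize exp (f (angleMap (deriv f) x)) = b at *
  generalize deriv (deriv f) (angleMap (deriv f) x) = v' at *
  generalize deriv (deriv f) x = u' at *
  generalize deriv f x = u at *
  have hs : 0 < 1 + u ^ 2 := by positivity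
  have h : (a * b) ^ 2 * ((1 + u ^ 2) * (v' + u') + u' * v') = 0 := by linear_combination -hk
  have h' := (mul_eq_zero.1 h).resolve_left (by positivity)
  field_simp
  linear_combination h'

end Exp

/-- Every strongly convex centrally symmetric domain can be `C^k`-approximated by
a smooth one whose symplectic billiard map has only finitely many 4-periodic
orbits, all non-degenerate. -/
theorem approx_nondegenerate_four_periodic (k : ℕ) (hk : 2 ≤ k) (p : ℝ → ℝ)
    (hp : ContDiff ℝ k p) (hper : ∀ θ, p (θ + Real.pi) = p θ)
    (hpos : ∀ θ, 0 < p θ) (hconv : ∀ θ, 0 < p θ + deriv (deriv p) θ) :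
    ∀ ε > 0, ∃ pε : ℝ → ℝ,
      ContDiff ℝ (⊤ : ℕ∞) pε ∧ (∀ θ, pε (θ + Real.pi) = pε θ) ∧
      (∀ θ, 0 < pε θ) ∧ (∀ θ, 0 < pε θ + deriv (deriv pε) θ) ∧
      (∀ j ≤ k, ∀ θ, |iteratedDeriv j (fun t => p t - pε t) θ| < ε) ∧
      {θ ∈ Set.Ico 0 Real.pi | Gmap pε θ = 0}.Finite ∧
      (∀ θ, Gmap pε θ = 0 → kMap pε θ ≠ 1) := by
  intro ε hε
  have hpper : Periodic p π := hper
  have h2 : ∀ f : ℝ → ℝ, iteratedDeriv 2 f = deriv (deriv f) := fun f => by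
    rw [iteratedDeriv_succ, iteratedDeriv_one]
  have hp2 : ContDiff ℝ 2 p := hp.of_le (by exact_mod_cast hk)
  have hp'' : Continuous (deriv (deriv p)) := h2 p ▸ hp2.continuous_iteratedDeriv 2 le_rfl
  obtain ⟨c₀, hc₀, hpc₀⟩ := exists_pos_le_of_periodic hp.continuous hpper hpos
  obtain ⟨c₂, hc₂, hpc₂⟩ := exists_pos_le_of_periodic (hp.continuous.add hp'')
    (hpper.add (periodic_deriv (periodic_deriv hpper))) hconv
  obtain ⟨q, hq, hqper, hpq⟩ := exists_smooth_periodic_approx k hp hpper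
    (lt_min hε (lt_min hc₀ (half_pos hc₂)))
  have hq0 : ∀ x, |p x - q x| < min ε (min c₀ (c₂ / 2)) := by simpa using hpq 0 k.zero_le
  have hq2 : ∀ x, |deriv (deriv p) x - deriv (deriv q) x| < min ε (min c₀ (c₂ / 2)) := by
    intro x
    have := hpq 2 hk x
    rwa [iteratedDeriv_fun_sub hp2.contDiffAt (contDiff_infty.1 hq 2).contDiffAt,
      h2, h2] at this
  simp only [lt_min_iff] at hq0 hq2
  have hqpos : ∀ x, 0 < q x := fun x => by
    linarith [(abs_lt.1 (hq0 x).2.1).2, hpc₀ x]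
  have hqconv : ∀ x, 0 < q x + deriv (deriv q) x := fun x => by
    have := hpc₂ x
    simp only [Pi.add_apply] at this
    linarith [(abs_lt.1 (hq0 x).2.2).2, (abs_lt.1 (hq2 x).2.2).2]
  have hf : ContDiff ℝ ∞ fun x => log (q x) := hq.log fun x => (hqpos x).ne'
  have hfper : Periodic (fun x => log (q x)) π := fun x => by simp only [hqper x]
  obtain ⟨s, g, hg, hgper, hfreq⟩ := exists_family_frequently_nondegenerate hf hfper
  set F : (s → ℝ) → ℝ → ℝ := affineFamily (fun x => log (q x)) g
  set Q : (s → ℝ) → ℝ → ℝ := fun t x => exp (F t x)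
  have hF : ContDiff ℝ ∞ (uncurry F) := contDiff_affineFamily hf hg
  have hFt : ∀ t, ContDiff ℝ ∞ (F t) := fun t => hF.comp (contDiff_const.prodMk contDiff_id)
  have hQ : ContDiff ℝ ∞ (uncurry Q) := hF.exp
  have hQper : ∀ t, Periodic (Q t) π := fun t x => by
    simp only [Q, F, affineFamily_periodic hfper hgper t x]
  have hQ0 : Q 0 = q := by
    funext x
    simp only [Q, F, affineFamily_zero, exp_log (hqpos x)]
  have hclose : ∀ᶠ t in 𝓝 (0 : s → ℝ), ∀ j ∈ Iic k, ∀ x,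
      |iteratedDeriv j (fun y => p y - Q t y) x| < ε := by
    refine (eventually_all_finite (finite_Iic k)).2 fun j hj => ?_
    refine eventually_forall_lt_of_periodic
      (F := fun t x => |iteratedDeriv j (fun y => p y - Q t y) x|) ?_ ?_ ?_
    · have hsmooth : ContDiff ℝ (0 + j : ℕ) (uncurry fun t y => p y - Q t y) := by
        refine ContDiff.sub ((hp.of_le ?_).comp contDiff_snd) (contDiff_infty.1 hQ _)
        rw [zero_add]
        exact_mod_cast hj
      exact continuous_abs.comp (contDiff_iteratedDeriv_param (n := 0) j hsmooth).continuous
    · intro t x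
      have hsub : Periodic (fun y => p y - Q t y) π := hpper.sub (hQper t)
      simp only [periodic_iteratedDeriv hsub j x]
    · intro x
      simp only [hQ0]
      exact (hpq j hj x).trans_le (min_le_left _ _)
  have hconvex : ∀ᶠ t in 𝓝 (0 : s → ℝ), ∀ x, -(Q t x + iteratedDeriv 2 (Q t) x) < 0 := by
    refine eventually_forall_lt_of_periodic
      (F := fun t x => -(Q t x + iteratedDeriv 2 (Q t) x)) ?_ ?_ ?_
    · exact (hQ.continuous.add (contDiff_iteratedDeriv_param (n := 0) 2
        (contDiff_infty.1 hQ _)).continuous).neg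
    · intro t x
      simp only [hQper t x, periodic_iteratedDeriv (hQper t) 2 x]
    · intro x
      rw [hQ0, h2]
      linarith [hqconv x]
  obtain ⟨t, ht, htclose, htconv⟩ := (hfreq.and_eventually (hclose.and hconvex)).exists
  have hFd : Differentiable ℝ (F t) := (hFt t).differentiable (by simp)
  have hFd' : Differentiable ℝ (deriv (F t)) :=
    (contDiff_infty_iff_deriv.1 (hFt t)).2.differentiable (by simp)
  rw [← deriv_affineFamily (hf.differentiable (by simp))
    fun i => (hg i).differentiable (by simp)] at ht
  refine ⟨Q t, (hFt t).exp, hQper t, fun x => exp_pos _, fun x => ?_, htclose, ?_, ?_⟩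
  · rw [← h2]
    linarith [htconv x]
  · simp only [Q, gmap_exp_comp hFd]
    exact finite_zeros_angleGap hFd' ht
  · exact fun x hG hk => ht x (isDegenerateAt_of_kMap_eq_one hFd hFd' hG hk)
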